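/- Let G = (V,E) be a finite simple graph and let β : E → ℝ satisfy β(e) ≥ 0 for all e ∈ E. Define p(e) = 1 − exp(−2β(e)) for each edge e. Then Z_spins(β) = (∏_{e ∈ E} exp(β(e))) · Z_rc(p). -/

import Mathlib

open Finset

variable {V : Type*} [Fintype V] [DecidableEq V]

/-- An edge subset is *even* if every vertex has even degree in it. -/
def IsEvenSubgraph (y : Finset (Sym2 V)) : Prop :=
  ∀ i : V, Even ((y.filter (fun e => i ∈ e)).card)

instance (y : Finset (Sym2 V)) : Decidable (IsEvenSubgraph y) :=
  inferInstanceAs (Decidable (∀ i : V, Even ((y.filter (fun e => i ∈ e)).card)))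

/-- Number of connected components of the graph `(V, z)` (isolated vertices count). -/
noncomputable def numComponents (z : Finset (Sym2 V)) : ℕ :=
  Nat.card (SimpleGraph.fromEdgeSet (z : Set (Sym2 V))).ConnectedComponent

/-- The product `x i * x j` of the two spins at the endpoints of an edge, as a real number. -/
def edgeSpinProd (x : V → ℤˣ) : Sym2 V → ℝ :=
  Sym2.lift ⟨fun i j => ((x i : ℤ) : ℝ) * ((x j : ℤ) : ℝ), fun i j => by ring⟩

/-- Spins partition function. -/
noncomputable def Zspins (G : SimpleGraph V) [DecidableRel G.Adj] (β : Sym2 V → ℝ) : ℝ :=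
  ∑ x : V → ℤˣ, ∏ e ∈ G.edgeFinset, Real.exp (β e * edgeSpinProd x e)

/-- Subgraphs-world partition function. -/
noncomputable def Zsubs (G : SimpleGraph V) [DecidableRel G.Adj] (lam : Sym2 V → ℝ) : ℝ :=
  ∑ y ∈ G.edgeFinset.powerset.filter (fun y => IsEvenSubgraph y), ∏ e ∈ y, lam e

/-- Random-cluster partition function. -/
noncomputable def Zrc (G : SimpleGraph V) [DecidableRel G.Adj] (p : Sym2 V → ℝ) : ℝ :=
  ∑ z ∈ G.edgeFinset.powerset,
    (∏ e ∈ z, p e) * (∏ e ∈ G.edgeFinset \ z, (1 - p e)) * 2 ^ numComponents z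

/-- Functions that agree across every edge of `H` are the functions on its connected components. -/
def SimpleGraph.locallyConstantEquiv {W α : Type*} (H : SimpleGraph W) :
    {x : W → α // ∀ i j, H.Adj i j → x i = x j} ≃ (H.ConnectedComponent → α) where
  toFun x := SimpleGraph.ConnectedComponent.lift x.1 fun v w p _ => by
    induction p with
    | nil => rfl
    | cons h _ ih => exact (x.2 _ _ h).trans (ih (by simp_all))
  invFun f := ⟨fun v => f (H.connectedComponentMk v), fun i j h =>
    congrArg f (SimpleGraph.ConnectedComponent.sound h.reachable)⟩
  left_inv _ := rfl
  right_inv f := by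
    funext c
    induction c using SimpleGraph.ConnectedComponent.ind
    rfl

lemma edgeSpinProd_mk {W : Type*} (x : W → ℤˣ) (i j : W) :
    edgeSpinProd x s(i, j) = if x i = x j then 1 else -1 := by
  rcases Int.units_eq_one_or (x i) with hi | hi <;>
    rcases Int.units_eq_one_or (x j) with hj | hj <;> simp [edgeSpinProd, hi, hj]

lemma edgeSpinProd_eq_one_or_neg_one {W : Type*} (x : W → ℤˣ) (e : Sym2 W) :
    edgeSpinProd x e = 1 ∨ edgeSpinProd x e = -1 := by
  induction e with
  | h i j =>
    rw [edgeSpinProd_mk]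
    split_ifs <;> simp

lemma forall_edgeSpinProd_eq_one_iff {W : Type*} (z : Finset (Sym2 W)) (x : W → ℤˣ) :
    (∀ e ∈ z, edgeSpinProd x e = 1) ↔
      ∀ i j, (SimpleGraph.fromEdgeSet (z : Set (Sym2 W))).Adj i j → x i = x j := by
  have key : ∀ i j, edgeSpinProd x s(i, j) = 1 ↔ x i = x j := fun i j => by
    rw [edgeSpinProd_mk]
    split_ifs with h <;> norm_num [h]
  constructor
  · intro h i j hij
    exact (key i j).1 (h _ (by simpa using hij.1))
  · intro h e he
    induction e with
    | h i j =>
      refine (key i j).2 ?_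
      by_cases hij : i = j
      · rw [hij]
      · exact h i j (by simpa using ⟨he, hij⟩)

open Classical in
/-- There are two choices of spin on each component of `(V, z)`. -/
lemma sum_prod_indicator_edgeSpinProd (z : Finset (Sym2 V)) :
    ∑ x : V → ℤˣ, ∏ e ∈ z, (if edgeSpinProd x e = 1 then (1 : ℝ) else 0) =
      2 ^ numComponents z := by
  simp_rw [Finset.prod_ite_zero, Finset.prod_const_one, Finset.sum_boole,
    forall_edgeSpinProd_eq_one_iff, ← Fintype.card_subtype]
  rw [Fintype.card_eq_nat_card, Nat.card_congr (SimpleGraph.locallyConstantEquiv _), Nat.card_fun]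
  simp [numComponents]

open Classical in
/-- The Edwards–Sokal expansion of a single edge weight. -/
lemma exp_mul_edgeSpinProd {W : Type*} (b : ℝ) (x : W → ℤˣ) (e : Sym2 W) :
    Real.exp (b * edgeSpinProd x e) =
      Real.exp b * ((1 - Real.exp (-2 * b)) * (if edgeSpinProd x e = 1 then 1 else 0) +
        (1 - (1 - Real.exp (-2 * b)))) := by
  rcases edgeSpinProd_eq_one_or_neg_one x e with h | h
  · simp [h]
  · rw [h, if_neg (by norm_num), mul_zero, zero_add, sub_sub_cancel, ← Real.exp_add]
    ring_nf

/-- `Z_spins(β) = (∏ exp β(e)) ⬝ Z_rc(p)` where `p(e) = 1 - exp (-2 β(e))`. -/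
theorem spins_eq_rc (G : SimpleGraph V) [DecidableRel G.Adj]
    (β : Sym2 V → ℝ) (hβ : ∀ e ∈ G.edgeFinset, 0 ≤ β e) :
    Zspins G β =
      (∏ e ∈ G.edgeFinset, Real.exp (β e)) *
        Zrc G (fun e => 1 - Real.exp (-2 * β e)) := by
  classical
  simp_rw [Zspins, Zrc, exp_mul_edgeSpinProd, Finset.prod_mul_distrib, ← Finset.mul_sum]
  congr 1
  simp_rw [Finset.prod_add, Finset.prod_mul_distrib]
  rw [Finset.sum_comm]
  refine Finset.sum_congr rfl fun z _ => ?_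
  rw [← sum_prod_indicator_edgeSpinProd, Finset.mul_sum]
  exact Finset.sum_congr rfl fun x _ => by ring
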